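/- Let ℓ > 0, ν ∈ ℝ, ε ∈ (0,1), and let ω = ω(U,v,w) be a C² function on (−ε,ε)×ℝ². For u > 0 set R = √(u²+v²+ℓ²) and define P(u,v,w) = log u − log R + ω(u/R, v, w) wherever 0 < u/R < ε. Assume that for all (u,v,w) with u > 0 and u/R < ε the following Hamilton–Jacobi equation holds: (u²/R⁴)·[ (R⁴+4ν²u²v²)·(∂_u P)² + (R⁴+ν²(R²−2u²)²)·(∂_v P)² + (∂_w P)² + 4ν²uv(R²−2u²)·(∂_u P)(∂_v P) − 4νuv·(∂_u P)(∂_w P) − 2ν(R²−2u²)·(∂_v P)(∂_w P) ] = 1. Then for all (v,w) ∈ ℝ²: ∂_U ω(0,v,w) = 0, and, writing φ(v,w) = ω(0,v,w), ∂²_U ω(0,v,w) = −(1/2)·[ (1+ν²)(v²+ℓ²)·(∂_v φ)² + (∂_w φ)²/(v²+ℓ²) − 2ν·(∂_v φ)(∂_w φ) + (1+ν²)·v²/(v²+ℓ²) − 2 + 2(ν²−1)·v·∂_v φ − 2ν·v·(∂_w φ)/(v²+ℓ²) ]. -/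

import Mathlib

/-- The right-hand side after dividing the Hamilton-Jacobi equation by `U ^ 2`. -/
noncomputable def hjG (ν v a U A B C : ℝ) : ℝ :=
  -(((4 * ν ^ 2 * v ^ 2 * ((1 - U ^ 2) / a)) * (1 - U ^ 2) ^ 2 + (-2 + U ^ 2)) * (1 + U * A) ^ 2
    + (a / (1 - U ^ 2) * (1 + ν ^ 2 * (1 - 2 * U ^ 2) ^ 2)
        * (B - v * (1 + U * A) * ((1 - U ^ 2) / a)) ^ 2
      + C ^ 2 * ((1 - U ^ 2) / a)
      + 4 * ν ^ 2 * v * (1 - U ^ 2) * (1 + U * A) * (1 - 2 * U ^ 2)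
        * (B - v * (1 + U * A) * ((1 - U ^ 2) / a))
      - 4 * ν * v * (1 - U ^ 2) * (1 + U * A) * C * ((1 - U ^ 2) / a)
      - 2 * ν * (1 - 2 * U ^ 2) * (B - v * (1 + U * A) * ((1 - U ^ 2) / a)) * C))

/-- The algebra: from the Hamilton-Jacobi equation to the reduced form. -/
lemma hj_algebra (ν v a U A B C r : ℝ) (ha : 0 < a) (hU : 0 < U) (hU1 : U < 1) (hr : 0 < r)
    (hra : r ^ 2 = a / (1 - U ^ 2)) (Pu Pv : ℝ)
    (hPu : Pu = (1 - U ^ 2) * (1 + U * A) / (U * r)) (hPv : Pv = B - v * (1 + U * A) / r ^ 2)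
    (h : ((U * r) ^ 2 / r ^ 4) *
        ((r ^ 4 + 4 * ν ^ 2 * (U * r) ^ 2 * v ^ 2) * Pu ^ 2
          + (r ^ 4 + ν ^ 2 * (r ^ 2 - 2 * (U * r) ^ 2) ^ 2) * Pv ^ 2
          + C ^ 2
          + 4 * ν ^ 2 * (U * r) * v * (r ^ 2 - 2 * (U * r) ^ 2) * Pu * Pv
          - 4 * ν * (U * r) * v * Pu * C
          - 2 * ν * (r ^ 2 - 2 * (U * r) ^ 2) * Pv * C) = 1) :
    2 * A + U * A ^ 2 = U * hjG ν v a U A B C := by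
  have h1 : 0 < 1 - U ^ 2 := by nlinarith
  have hk : (1 - U ^ 2) / a = 1 / r ^ 2 := by rw [hra]; field_simp
  unfold hjG
  rw [hk, ← hra]
  apply mul_left_cancel₀ hU.ne'
  set S := 1 - U ^ 2 with hS
  have key : ((U * r) ^ 2 / r ^ 4) *
        ((r ^ 4 + 4 * ν ^ 2 * (U * r) ^ 2 * v ^ 2) * Pu ^ 2
          + (r ^ 4 + ν ^ 2 * (r ^ 2 - 2 * (U * r) ^ 2) ^ 2) * Pv ^ 2
          + C ^ 2
          + 4 * ν ^ 2 * (U * r) * v * (r ^ 2 - 2 * (U * r) ^ 2) * Pu * Pv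
          - 4 * ν * (U * r) * v * Pu * C
          - 2 * ν * (r ^ 2 - 2 * (U * r) ^ 2) * Pv * C) =
      (1 + 4 * ν ^ 2 * U ^ 2 * v ^ 2 / r ^ 2) * S ^ 2 * (1 + U * A) ^ 2
      + U ^ 2 * (r ^ 2 * (1 + ν ^ 2 * (1 - 2 * U ^ 2) ^ 2) * Pv ^ 2
      + C ^ 2 * (1 / r ^ 2)
      + 4 * ν ^ 2 * v * S * (1 + U * A) * (1 - 2 * U ^ 2) * Pv
      - 4 * ν * v * S * (1 + U * A) * C * (1 / r ^ 2)
      - 2 * ν * (1 - 2 * U ^ 2) * Pv * C) := by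
    rw [hPu]
    clear_value S
    field_simp
    ring
  rw [key] at h
  have e : v * (1 + U * A) * (1 / r ^ 2) = v * (1 + U * A) / r ^ 2 := by ring
  rw [e, ← hPv]
  have e2 : 4 * ν ^ 2 * U ^ 2 * v ^ 2 / r ^ 2 = 4 * ν ^ 2 * U ^ 2 * v ^ 2 * (1 / r ^ 2) := by ring
  rw [e2] at h
  generalize 1 / r ^ 2 = K at *
  generalize r ^ 2 = Q at *
  have : S = 1 - U ^ 2 := hS
  clear_value S
  subst this
  linear_combination h

lemma hj_partials (f : ℝ × ℝ × ℝ → ℝ) (x y z : ℝ) (hf : DifferentiableAt ℝ f (x, y, z)) :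
    HasDerivAt (fun t => f (t, y, z)) (fderiv ℝ f (x, y, z) (1, 0, 0)) x ∧
    HasDerivAt (fun t => f (x, t, z)) (fderiv ℝ f (x, y, z) (0, 1, 0)) y ∧
    HasDerivAt (fun t => f (x, y, t)) (fderiv ℝ f (x, y, z) (0, 0, 1)) z := by
  refine ⟨?_, ?_, ?_⟩
  · exact HasFDerivAt.comp_hasDerivAt (f := fun t : ℝ => (t, y, z)) x hf.hasFDerivAt
      ((hasDerivAt_id x).prodMk ((hasDerivAt_const x y).prodMk (hasDerivAt_const x z)))
  · exact HasFDerivAt.comp_hasDerivAt (f := fun t : ℝ => (x, t, z)) y hf.hasFDerivAt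
      ((hasDerivAt_const y x).prodMk ((hasDerivAt_id y).prodMk (hasDerivAt_const y z)))
  · exact HasFDerivAt.comp_hasDerivAt (f := fun t : ℝ => (x, y, t)) z hf.hasFDerivAt
      ((hasDerivAt_const z x).prodMk ((hasDerivAt_const z y).prodMk (hasDerivAt_id z)))

lemma hj_two (f : ℝ × ℝ × ℝ → ℝ) (U v w : ℝ) (hf : DifferentiableAt ℝ f (U, v, w))
    (p : ℝ → ℝ) (p' : ℝ) (hp : HasDerivAt p p' v) (hpv : p v = U) :
    HasDerivAt (fun t => f (p t, t, w))
      (p' * fderiv ℝ f (U, v, w) (1, 0, 0) + fderiv ℝ f (U, v, w) (0, 1, 0)) v := by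
  subst hpv
  have := HasFDerivAt.comp_hasDerivAt (f := fun t : ℝ => (p t, t, w)) v hf.hasFDerivAt
      (hp.prodMk ((hasDerivAt_id v).prodMk (hasDerivAt_const v w)))
  refine HasDerivAt.congr_deriv this ?_
  have e : ((p', 1, 0) : ℝ × ℝ × ℝ) = p' • ((1, 0, 0) : ℝ × ℝ × ℝ) + (0, 1, 0) := by
    simp
  rw [e, map_add, map_smul, smul_eq_mul]

/-- Proposition 6.4: Taylor coefficients at U = 0 of the solution ω of the
Hamilton–Jacobi equation |d log ρ|²_g = 1 for ρ = e^ω · u/R, R = √(u²+v²+ℓ²),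
in the model metric with parameters ℓ > 0 and ν: the first-order coefficient
vanishes and the second-order coefficient is explicitly computed. -/
theorem stmt_8 (ℓ : ℝ) (hℓ : 0 < ℓ) (ν : ℝ) (ε : ℝ) (hε : ε ∈ Set.Ioo (0 : ℝ) 1)
    (ω : ℝ → ℝ → ℝ → ℝ)
    (hω : ContDiffOn ℝ 2 (fun p : ℝ × ℝ × ℝ => ω p.1 p.2.1 p.2.2)
      (Set.Ioo (-ε) ε ×ˢ (Set.univ : Set (ℝ × ℝ))))
    (P : ℝ → ℝ → ℝ → ℝ)
    (hP : ∀ u v w : ℝ, 0 < u → u / Real.sqrt (u ^ 2 + v ^ 2 + ℓ ^ 2) < ε →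
      P u v w = Real.log u - Real.log (Real.sqrt (u ^ 2 + v ^ 2 + ℓ ^ 2))
        + ω (u / Real.sqrt (u ^ 2 + v ^ 2 + ℓ ^ 2)) v w)
    (hHJ : ∀ u v w : ℝ, 0 < u → u / Real.sqrt (u ^ 2 + v ^ 2 + ℓ ^ 2) < ε →
      (u ^ 2 / Real.sqrt (u ^ 2 + v ^ 2 + ℓ ^ 2) ^ 4) *
        ((Real.sqrt (u ^ 2 + v ^ 2 + ℓ ^ 2) ^ 4 + 4 * ν ^ 2 * u ^ 2 * v ^ 2) *
            (deriv (fun t => P t v w) u) ^ 2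
          + (Real.sqrt (u ^ 2 + v ^ 2 + ℓ ^ 2) ^ 4
              + ν ^ 2 * (Real.sqrt (u ^ 2 + v ^ 2 + ℓ ^ 2) ^ 2 - 2 * u ^ 2) ^ 2) *
            (deriv (fun t => P u t w) v) ^ 2
          + (deriv (fun t => P u v t) w) ^ 2
          + 4 * ν ^ 2 * u * v * (Real.sqrt (u ^ 2 + v ^ 2 + ℓ ^ 2) ^ 2 - 2 * u ^ 2) *
            (deriv (fun t => P t v w) u) * (deriv (fun t => P u t w) v)
          - 4 * ν * u * v *
            (deriv (fun t => P t v w) u) * (deriv (fun t => P u v t) w)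
          - 2 * ν * (Real.sqrt (u ^ 2 + v ^ 2 + ℓ ^ 2) ^ 2 - 2 * u ^ 2) *
            (deriv (fun t => P u t w) v) * (deriv (fun t => P u v t) w)) = 1) :
    ∀ v w : ℝ,
      deriv (fun t => ω t v w) 0 = 0 ∧
      iteratedDeriv 2 (fun t => ω t v w) 0 =
        -(1 / 2) *
          ((1 + ν ^ 2) * (v ^ 2 + ℓ ^ 2) * (deriv (fun t => ω 0 t w) v) ^ 2
            + (deriv (fun t => ω 0 v t) w) ^ 2 / (v ^ 2 + ℓ ^ 2)
            - 2 * ν * (deriv (fun t => ω 0 t w) v) * (deriv (fun t => ω 0 v t) w)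
            + (1 + ν ^ 2) * v ^ 2 / (v ^ 2 + ℓ ^ 2) - 2
            + 2 * (ν ^ 2 - 1) * v * (deriv (fun t => ω 0 t w) v)
            - 2 * ν * v * (deriv (fun t => ω 0 v t) w) / (v ^ 2 + ℓ ^ 2)) := by
  intro v w
  obtain ⟨hε0, hε1⟩ := hε
  set f : ℝ × ℝ × ℝ → ℝ := fun p => ω p.1 p.2.1 p.2.2 with hf
  have hopen : IsOpen (Set.Ioo (-ε) ε ×ˢ (Set.univ : Set (ℝ × ℝ))) :=
    isOpen_Ioo.prod isOpen_univ
  have hC : ∀ U ∈ Set.Ioo (-ε) ε, ∀ y z : ℝ, ContDiffAt ℝ 2 f (U, y, z) := fun U hU y z =>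
    hω.contDiffAt (hopen.mem_nhds ⟨hU, trivial⟩)
  have hD : ∀ U ∈ Set.Ioo (-ε) ε, ∀ y z : ℝ, DifferentiableAt ℝ f (U, y, z) :=
    fun U hU y z => (hC U hU y z).differentiableAt (by norm_num)
  have h0 : (0 : ℝ) ∈ Set.Ioo (-ε) ε := ⟨by linarith, hε0⟩
  have ha : 0 < v ^ 2 + ℓ ^ 2 := by positivity
  set a := v ^ 2 + ℓ ^ 2 with hadef
  set A : ℝ → ℝ := fun U => fderiv ℝ f (U, v, w) (1, 0, 0) with hA
  set B : ℝ → ℝ := fun U => fderiv ℝ f (U, v, w) (0, 1, 0) with hB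
  set C : ℝ → ℝ := fun U => fderiv ℝ f (U, v, w) (0, 0, 1) with hCC
  -- the reduced equation
  have main : ∀ U, 0 < U → U < ε → 2 * A U + U * A U ^ 2 = U * hjG ν v a U (A U) (B U) (C U) := by
    intro U hU hUε
    have hU1 : U < 1 := by linarith
    have hS : 0 < 1 - U ^ 2 := by nlinarith
    have hUm : U ∈ Set.Ioo (-ε) ε := ⟨by linarith, hUε⟩
    set r := Real.sqrt (a / (1 - U ^ 2)) with hr
    have hrpos : 0 < r := Real.sqrt_pos.2 (by positivity)
    have hra : r ^ 2 = a / (1 - U ^ 2) := Real.sq_sqrt (by positivity)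
    have hra' : r ^ 2 * (1 - U ^ 2) = a := by rw [hra]; field_simp
    have hsum : (U * r) ^ 2 + v ^ 2 + ℓ ^ 2 = r ^ 2 := by
      rw [hadef] at hra'; linear_combination -hra'
    have hR : Real.sqrt ((U * r) ^ 2 + v ^ 2 + ℓ ^ 2) = r := by
      rw [hsum]; exact Real.sqrt_sq hrpos.le
    have hu : 0 < U * r := by positivity
    have hUr : U * r / r = U := by field_simp
    have hpos : ∀ s t : ℝ, 0 < s ^ 2 + t ^ 2 + ℓ ^ 2 := fun s t => by positivity
    have hH := hHJ (U * r) v w hu (by rw [hR, hUr]; exact hUε)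
    rw [hR] at hH
    -- derivative in w
    have hPw : deriv (fun t => P (U * r) v t) w = C U := by
      have : (fun t => P (U * r) v t) = fun t => Real.log (U * r) - Real.log r + f (U, v, t) := by
        funext t
        rw [hP (U * r) v t hu (by rw [hR, hUr]; exact hUε), hR, hUr]
      rw [this]
      exact ((hj_partials f U v w (hD U hUm v w)).2.2.const_add _).deriv
    -- derivative in u
    have hPu : deriv (fun t => P t v w) (U * r) = (1 - U ^ 2) * (1 + U * A U) / (U * r) := by
      have hev : (fun t => P t v w) =ᶠ[nhds (U * r)] fun t =>
          Real.log t - Real.log (Real.sqrt (t ^ 2 + v ^ 2 + ℓ ^ 2))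
            + f (t / Real.sqrt (t ^ 2 + v ^ 2 + ℓ ^ 2), v, w) := by
        have hc : ContinuousAt (fun t : ℝ => t / Real.sqrt (t ^ 2 + v ^ 2 + ℓ ^ 2)) (U * r) := by
          apply ContinuousAt.div (by fun_prop) (by fun_prop)
          rw [hR]; exact hrpos.ne'
        have h2 := hc.eventually_lt continuousAt_const (show _ < ε by rw [hR, hUr]; exact hUε)
        filter_upwards [h2, lt_mem_nhds hu] with t ht1 ht2
        exact hP t v w ht2 ht1
      rw [hev.deriv_eq]
      have hs : HasDerivAt (fun t : ℝ => Real.sqrt (t ^ 2 + v ^ 2 + ℓ ^ 2)) U (U * r) := by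
        have := ((((hasDerivAt_pow 2 (U * r)).add_const (v ^ 2)).add_const (ℓ ^ 2)).sqrt
          (hpos _ _).ne')
        refine HasDerivAt.congr_deriv this ?_
        rw [hR]; norm_num; field_simp
      have hl : HasDerivAt (fun t : ℝ => Real.log (Real.sqrt (t ^ 2 + v ^ 2 + ℓ ^ 2)))
          (U / r) (U * r) := by
        have := hs.log (by rw [hR]; exact hrpos.ne')
        rwa [hR] at this
      have hq : HasDerivAt (fun t : ℝ => t / Real.sqrt (t ^ 2 + v ^ 2 + ℓ ^ 2))
          ((1 - U ^ 2) / r) (U * r) := by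
        have := (hasDerivAt_id (U * r)).div hs (by rw [hR]; exact hrpos.ne')
        rw [hR] at this
        refine HasDerivAt.congr_deriv this ?_
        simp only [id]; field_simp
      have hcomp := HasDerivAt.comp_of_eq (h := fun t : ℝ => t / Real.sqrt (t ^ 2 + v ^ 2 + ℓ ^ 2))
        (U * r) (hj_partials f U v w (hD U hUm v w)).1 hq (by simp only [hR, hUr])
      have := (((Real.hasDerivAt_log hu.ne').sub hl).add hcomp).deriv
      refine Eq.trans this ?_
      change (U * r)⁻¹ - U / r + A U * ((1 - U ^ 2) / r) = _
      field_simp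
    -- derivative in v
    have hPv : deriv (fun t => P (U * r) t w) v = B U - v * (1 + U * A U) / r ^ 2 := by
      have hev : (fun t => P (U * r) t w) =ᶠ[nhds v] fun t =>
          Real.log (U * r) - Real.log (Real.sqrt ((U * r) ^ 2 + t ^ 2 + ℓ ^ 2))
            + f (U * r / Real.sqrt ((U * r) ^ 2 + t ^ 2 + ℓ ^ 2), t, w) := by
        have hc : ContinuousAt (fun t : ℝ => U * r / Real.sqrt ((U * r) ^ 2 + t ^ 2 + ℓ ^ 2)) v := by
          apply ContinuousAt.div (by fun_prop) (by fun_prop)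
          rw [hR]; exact hrpos.ne'
        have h2 := hc.eventually_lt continuousAt_const (show _ < ε by rw [hR, hUr]; exact hUε)
        filter_upwards [h2] with t ht1
        exact hP (U * r) t w hu ht1
      rw [hev.deriv_eq]
      have hs : HasDerivAt (fun t : ℝ => Real.sqrt ((U * r) ^ 2 + t ^ 2 + ℓ ^ 2)) (v / r) v := by
        have := ((((hasDerivAt_pow 2 v).const_add ((U * r) ^ 2)).add_const (ℓ ^ 2)).sqrt
          (hpos _ _).ne')
        refine HasDerivAt.congr_deriv this ?_
        rw [hR]; norm_num; field_simp
      have hl : HasDerivAt (fun t : ℝ => Real.log (Real.sqrt ((U * r) ^ 2 + t ^ 2 + ℓ ^ 2)))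
          (v / r / r) v := by
        have := hs.log (by rw [hR]; exact hrpos.ne')
        rwa [hR] at this
      have hq : HasDerivAt (fun t : ℝ => U * r / Real.sqrt ((U * r) ^ 2 + t ^ 2 + ℓ ^ 2))
          (-(U * v / r ^ 2)) v := by
        have := (hasDerivAt_const v (U * r)).div hs (by rw [hR]; exact hrpos.ne')
        rw [hR] at this
        refine HasDerivAt.congr_deriv this ?_
        field_simp; ring
      have hcomp := hj_two f U v w (hD U hUm v w) _ _ hq (by simp only [hR, hUr])
      have := ((hl.const_sub (Real.log (U * r))).add hcomp).deriv
      refine Eq.trans this ?_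
      change -(v / r / r) + (-(U * v / r ^ 2) * A U + B U) = _
      field_simp
      ring
    rw [hPw] at hH
    exact hj_algebra ν v a U (A U) (B U) (C U) r ha hU hU1 hrpos hra _ _ hPu hPv hH
  -- continuity of the first derivatives
  have hfd : ContinuousAt (fun U : ℝ => fderiv ℝ f (U, v, w)) 0 := by
    have h1 : ContinuousAt (fderiv ℝ f) (0, v, w) :=
      ((hC 0 h0 v w).fderiv_right (m := 1) (by norm_num)).continuousAt
    exact ContinuousAt.comp (f := fun U : ℝ => (U, v, w)) (x := 0) h1 (by fun_prop)
  have hAc : ContinuousAt A 0 := hfd.clm_apply continuousAt_const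
  have hBc : ContinuousAt B 0 := hfd.clm_apply continuousAt_const
  have hCc : ContinuousAt C 0 := hfd.clm_apply continuousAt_const
  have hGc : ContinuousAt (fun U => hjG ν v a U (A U) (B U) (C U)) 0 := by
    unfold hjG
    have hdiv : ContinuousAt (fun U : ℝ => a / (1 - U ^ 2)) 0 :=
      ContinuousAt.div (by fun_prop) (by fun_prop) (by norm_num)
    fun_prop
  have hA0 : A 0 = 0 := by
    have l1 : Filter.Tendsto (fun U => 2 * A U + U * A U ^ 2) (nhdsWithin 0 (Set.Ioi 0))
        (nhds (2 * A 0 + 0 * A 0 ^ 2)) :=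
      (show ContinuousAt (fun U => 2 * A U + U * A U ^ 2) 0 by fun_prop).tendsto.mono_left
        nhdsWithin_le_nhds
    have l2 : Filter.Tendsto (fun U => U * hjG ν v a U (A U) (B U) (C U))
        (nhdsWithin 0 (Set.Ioi 0)) (nhds (0 * hjG ν v a 0 (A 0) (B 0) (C 0))) :=
      (continuousAt_id.mul hGc).tendsto.mono_left nhdsWithin_le_nhds
    have l3 := tendsto_nhds_unique (l2.congr' (by
      filter_upwards [Ioo_mem_nhdsGT hε0] with U hU
      exact (main U hU.1 hU.2).symm)) l1
    linarith
  have hdA : ∀ U ∈ Set.Ioo (-ε) ε, deriv (fun t => ω t v w) U = A U := fun U hU =>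
    (hj_partials f U v w (hD U hU v w)).1.deriv
  have hdB : deriv (fun t => ω 0 t w) v = B 0 := (hj_partials f 0 v w (hD 0 h0 v w)).2.1.deriv
  have hdC : deriv (fun t => ω 0 v t) w = C 0 := (hj_partials f 0 v w (hD 0 h0 v w)).2.2.deriv
  refine ⟨(hdA 0 h0).trans hA0, ?_⟩
  have hAd : DifferentiableAt ℝ A 0 := by
    have h1 : DifferentiableAt ℝ (fderiv ℝ f) (0, v, w) :=
      ((hC 0 h0 v w).fderiv_right (m := 1) (by norm_num)).differentiableAt (by norm_num)
    have h2 : DifferentiableAt ℝ (fun U : ℝ => fderiv ℝ f (U, v, w)) 0 :=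
      DifferentiableAt.comp (f := fun U : ℝ => (U, v, w)) 0 h1 (by fun_prop)
    exact h2.clm_apply (differentiableAt_const _)
  have hit : iteratedDeriv 2 (fun t => ω t v w) 0 = deriv A 0 := by
    rw [iteratedDeriv_succ, iteratedDeriv_one]
    apply Filter.EventuallyEq.deriv_eq
    filter_upwards [isOpen_Ioo.mem_nhds h0] with U hU using hdA U hU
  have hsl : Filter.Tendsto (fun U => U⁻¹ * A U) (nhdsWithin 0 (Set.Ioi 0))
      (nhds (deriv A 0)) := by
    have := hAd.hasDerivAt.tendsto_slope_zero_right
    simpa [hA0] using this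
  have m1 : Filter.Tendsto (fun U => U⁻¹ * A U * (2 + U * A U)) (nhdsWithin 0 (Set.Ioi 0))
      (nhds (deriv A 0 * (2 + 0 * A 0))) :=
    hsl.mul ((show ContinuousAt (fun U => 2 + U * A U) 0 by fun_prop).tendsto.mono_left
      nhdsWithin_le_nhds)
  have m2 : Filter.Tendsto (fun U => hjG ν v a U (A U) (B U) (C U))
        (nhdsWithin 0 (Set.Ioi 0)) (nhds (hjG ν v a 0 (A 0) (B 0) (C 0))) :=
    hGc.tendsto.mono_left nhdsWithin_le_nhds
  have m3 := tendsto_nhds_unique (m2.congr' (by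
      filter_upwards [Ioo_mem_nhdsGT hε0] with U hU
      have hne : U ≠ 0 := hU.1.ne'
      apply mul_left_cancel₀ hne
      rw [← main U hU.1 hU.2]
      field_simp)) m1
  rw [hit, hdB, hdC]
  have m4 : deriv A 0 = hjG ν v a 0 (A 0) (B 0) (C 0) / 2 := by linarith
  rw [m4, hA0]
  clear_value a
  unfold hjG
  field_simp
  ring
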